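/- Let m ≤ n − 1 and let A_1,…,A_m be real symmetric n×n matrices. If the system xᵀ A_i x = x_i / x_n for i = 1,…,m, together with x_n ∈ (−1, 0) and ‖x‖ = 1, has no solution x ∈ ℝⁿ, then the system ⟨A_i, X⟩ = 0 for i = 1,…,m, X positive semidefinite, has a rank-one solution. -/

import Mathlib

open Matrix

/-- Evaluation at `1` of `t ↦ det (1 + t M)` is a combination of its values at enough nodes, with
weights independent of `M`. -/
theorem ContinuousLinearMap.det_one_add_eq_sum_lagrange {E : Type*} [NormedAddCommGroup E]
    [NormedSpace ℝ E] [FiniteDimensional ℝ E] (s : Finset ℝ)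
    (hs : Module.finrank ℝ E < s.card) (M : E →L[ℝ] E) :
    (1 + M).det = ∑ k ∈ s, (Lagrange.basis s id k).eval 1 * (1 + k • M).det := by
  let b := Module.finBasis ℝ E
  let N := LinearMap.toMatrix b b (M : E →ₗ[ℝ] E)
  let p : Polynomial ℝ :=
    Matrix.det ((Polynomial.X : Polynomial ℝ) • N.map Polynomial.C +
      (1 : Matrix (Fin (Module.finrank ℝ E)) (Fin (Module.finrank ℝ E)) ℝ).map Polynomial.C)
  have hp : p.degree < s.card := by
    refine lt_of_le_of_lt Polynomial.degree_le_natDegree ?_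
    have := Polynomial.natDegree_det_X_add_C_le N 1
    rw [Fintype.card_fin] at this
    exact_mod_cast this.trans_lt hs
  have heval (t : ℝ) : p.eval t = (1 + t • M).det := by
    have h1 : p.eval t = (1 + t • N).det := by
      rw [← Polynomial.coe_evalRingHom, RingHom.map_det]
      congr 1
      ext i j
      simp [Matrix.one_apply, apply_ite, add_comm, mul_comm t]
    rw [h1, ContinuousLinearMap.det, ← LinearMap.det_toMatrix b]
    congr 1
    simp [N, LinearMap.toMatrix_one]
  have h := congrArg (Polynomial.eval 1) (Lagrange.eq_interpolate (v := id) (s := s)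
    Function.injective_id.injOn hp)
  rw [heval, one_smul, Lagrange.interpolate_apply, Polynomial.eval_finsetSum] at h
  simpa [heval, mul_comm] using h

/-- Extension by zero of a Lipschitz map vanishing on the boundary sphere is Lipschitz. -/
theorem LipschitzOnWith.indicator_closedBall {E F : Type*} [NormedAddCommGroup E]
    [NormedSpace ℝ E] [NormedAddCommGroup F] {g : E → F} {R : ℝ} {L : NNReal}
    (hg : LipschitzOnWith L g (Metric.closedBall 0 R))
    (h0 : ∀ x ∈ Metric.sphere (0 : E) R, g x = 0) :
    LipschitzWith L ((Metric.closedBall (0 : E) R).indicator g) := by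
  have key : ∀ x ∈ Metric.closedBall (0 : E) R, ∀ y ∉ Metric.closedBall (0 : E) R,
      ‖g x‖ ≤ L * ‖x - y‖ := by
    intro x hx y hy
    rw [mem_closedBall_zero_iff] at hx hy
    obtain ⟨s, hs, hsR⟩ : ∃ s ∈ Set.Icc (0 : ℝ) 1, ‖x + s • (y - x)‖ = R := by
      refine intermediate_value_Icc (zero_le_one) (f := fun s : ℝ => ‖x + s • (y - x)‖)
        (by fun_prop) ⟨by simpa using hx, by simpa using (not_le.1 hy).le⟩
    have h1 := hg.norm_sub_le (mem_closedBall_zero_iff.2 hx) (mem_closedBall_zero_iff.2 hsR.le)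
    rw [h0 _ (mem_sphere_zero_iff_norm.2 hsR), sub_zero] at h1
    refine h1.trans (mul_le_mul_of_nonneg_left ?_ L.2)
    rw [sub_add_cancel_left, norm_neg, norm_smul, Real.norm_of_nonneg hs.1, norm_sub_rev y x]
    exact mul_le_of_le_one_left (norm_nonneg _) hs.2
  refine LipschitzWith.of_dist_le_mul fun x y => ?_
  rw [dist_eq_norm, dist_eq_norm]
  by_cases hx : x ∈ Metric.closedBall (0 : E) R <;> by_cases hy : y ∈ Metric.closedBall (0 : E) R
  · simpa [hx, hy] using hg.norm_sub_le hx hy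
  · simpa [Set.indicator_of_mem hx, Set.indicator_of_notMem hy] using key x hx y hy
  · simpa [Set.indicator_of_mem hy, Set.indicator_of_notMem hx, norm_sub_rev x y]
      using key y hy x hx
  · simp only [Set.indicator_of_notMem hx, Set.indicator_of_notMem hy, sub_self, norm_zero]
    positivity

/-- A perturbation of the identity by a map with small Lipschitz constant is bijective. -/
theorem LipschitzWith.bijective_id_add {E : Type*} [NormedAddCommGroup E] [CompleteSpace E]
    {g : E → E} {L : NNReal} (hg : LipschitzWith L g) (hL : L < 1) :
    Function.Bijective fun x => x + g x := by
  have hc (y : E) : ContractingWith L fun x => y - g x :=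
    ⟨hL, LipschitzWith.of_dist_le_mul fun a b => by
      simpa [dist_eq_norm, norm_sub_rev] using hg.dist_le_mul b a⟩
  refine ⟨fun a b hab => (hc (a + g a)).fixedPoint_unique' (x := a) (y := b) ?_ ?_, fun y =>
    ⟨(hc y).fixedPoint, ?_⟩⟩
  · simp [Function.IsFixedPt]
  · simp only [Function.IsFixedPt] at hab ⊢
    rw [hab, add_sub_cancel_right]
  · have := (hc y).fixedPoint_isFixedPt
    simp only [Function.IsFixedPt] at this
    exact eq_sub_iff_add_eq.1 this.symm

/-- There is no `C¹` retraction of a closed ball onto its boundary sphere. -/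
theorem not_exists_contDiff_retraction_sphere {E : Type*} [NormedAddCommGroup E]
    [InnerProductSpace ℝ E] [FiniteDimensional ℝ E] {R : ℝ} (hR : 0 < R) {K : E → E}
    (hK : ∀ x ∈ Metric.closedBall (0 : E) R, ContDiffAt ℝ 1 K x)
    (hKR : ∀ x ∈ Metric.closedBall (0 : E) R, ‖K x‖ = R)
    (hKs : ∀ x ∈ Metric.sphere (0 : E) R, K x = x) : False := by
  borelize E
  set μ : MeasureTheory.Measure E := MeasureTheory.Measure.addHaar
  have hcpt : IsCompact (Metric.closedBall (0 : E) R) := isCompact_closedBall 0 R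
  have hsub : Metric.ball (0 : E) R ⊆ Metric.closedBall 0 R := Metric.ball_subset_closedBall
  let g : E → E := fun x => K x - x
  have hg : ∀ x ∈ Metric.closedBall (0 : E) R, ContDiffAt ℝ 1 g x :=
    fun x hx => (hK x hx).sub contDiffAt_id
  have hgd : ContinuousOn (fderiv ℝ g) (Metric.closedBall (0 : E) R) :=
    fun x hx => ((hg x hx).continuousAt_fderiv one_ne_zero).continuousWithinAt
  obtain ⟨C, hC⟩ := hcpt.exists_bound_of_continuousOn hgd
  have hgL : LipschitzOnWith C.toNNReal g (Metric.closedBall 0 R) :=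
    Convex.lipschitzOnWith_of_nnnorm_fderiv_le (𝕜 := ℝ)
      (fun x hx => (hg x hx).differentiableAt one_ne_zero)
      (fun x hx => by
        rw [← NNReal.coe_le_coe]
        exact (hC x hx).trans (Real.le_coe_toNNReal C)) (convex_closedBall 0 R)
  have hGL := hgL.indicator_closedBall fun x hx => sub_eq_zero.2 (hKs x hx)
  set G := (Metric.closedBall (0 : E) R).indicator g with hG
  obtain ⟨δ, hδ, hdet⟩ : ∃ δ > 0, ∀ M : E →L[ℝ] E, ‖M‖ < δ → 0 < (1 + M).det := by
    have hcont : Continuous fun M : E →L[ℝ] E => (1 + M).det :=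
      ContinuousLinearMap.continuous_det.comp (continuous_const.add continuous_id)
    have := (hcont.tendsto 0).eventually_const_lt (u := 0)
      (by simp [ContinuousLinearMap.det])
    obtain ⟨δ, hδ, h⟩ := Metric.eventually_nhds_iff.1 this
    exact ⟨δ, hδ, fun M hM => h (by simpa using hM)⟩
  obtain ⟨τ, hτ, hτ1, hτL, hτδ⟩ : ∃ τ : ℝ, 0 < τ ∧ τ ≤ 1 ∧ τ * C.toNNReal < 1 ∧
      τ * C.toNNReal < δ := by
    have hpos : 0 < (C.toNNReal : ℝ) + 1 := by positivity
    have hm : 0 < min 1 δ := lt_min one_pos hδ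
    have h3 : min 1 δ / (C.toNNReal + 1) * C.toNNReal < min 1 δ := by
      rw [div_mul_eq_mul_div, div_lt_iff₀ hpos]
      nlinarith
    refine ⟨min 1 δ / (C.toNNReal + 1), div_pos hm hpos, ?_, h3.trans_le (min_le_left _ _),
      h3.trans_le (min_le_right _ _)⟩
    rw [div_le_one hpos]
    exact (min_le_left _ _).trans (by simp)
  have hvol : ∀ t ∈ Set.Ioo 0 τ,
      ∫ x in Metric.ball (0 : E) R, (1 + t • fderiv ℝ g x).det ∂μ =
        μ.real (Metric.ball (0 : E) R) := by
    rintro t ⟨ht0, htτ⟩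
    have htC : t * C.toNNReal ≤ τ * C.toNNReal :=
      mul_le_mul_of_nonneg_right htτ.le C.toNNReal.2
    have hbij : Function.Bijective fun x => x + t • G x := by
      refine LipschitzWith.bijective_id_add (g := fun x => t • G x)
        (L := t.toNNReal * C.toNNReal) ?_ ?_
      · refine LipschitzWith.of_dist_le_mul fun x y => ?_
        rw [dist_smul₀, Real.norm_of_nonneg ht0.le, NNReal.coe_mul, Real.coe_toNNReal t ht0.le,
          mul_assoc]
        exact mul_le_mul_of_nonneg_left (hGL.dist_le_mul x y) ht0.le
      · rw [← NNReal.coe_lt_coe, NNReal.coe_mul, Real.coe_toNNReal t ht0.le]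
        exact htC.trans_lt hτL
    have hGg : ∀ x ∈ Metric.ball (0 : E) R, G x = g x := fun x hx =>
      Set.indicator_of_mem (hsub hx) g
    have himage : (fun x => x + t • g x) '' Metric.ball 0 R = Metric.ball 0 R := by
      ext y
      constructor
      · rintro ⟨x, hx, rfl⟩
        have h1 : x + t • g x = (1 - t) • x + t • K x := by
          simp only [g]
          module
        have hxR := mem_ball_zero_iff.1 hx
        simp only [mem_ball_zero_iff, h1]
        refine (norm_add_le _ _).trans_lt ?_
        rw [norm_smul, norm_smul, hKR x (hsub hx), Real.norm_of_nonneg ht0.le,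
          Real.norm_of_nonneg (by linarith)]
        nlinarith
      · intro hy
        obtain ⟨x, hx⟩ := hbij.2 y
        simp only at hx
        have hxb : x ∈ Metric.ball (0 : E) R := by
          by_contra hxn
          have hGx : G x = 0 := by
            by_cases hxc : x ∈ Metric.closedBall (0 : E) R
            · have hxs : x ∈ Metric.sphere (0 : E) R := by
                rw [mem_ball_zero_iff, not_lt] at hxn
                rw [mem_sphere_zero_iff_norm]
                exact le_antisymm (mem_closedBall_zero_iff.1 hxc) hxn
              rw [hG, Set.indicator_of_mem hxc]
              exact sub_eq_zero.2 (hKs x hxs)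
            · exact Set.indicator_of_notMem hxc g
          rw [hGx, smul_zero, add_zero] at hx
          exact hxn (hx ▸ hy)
        exact ⟨x, hxb, by rw [← hx, hGg x hxb]⟩
    have hinj : Set.InjOn (fun x => x + t • g x) (Metric.ball 0 R) := by
      intro a ha b hb hab
      apply hbij.1
      simpa only [hGg a ha, hGg b hb] using hab
    have hderiv : ∀ x ∈ Metric.ball (0 : E) R, HasFDerivWithinAt (fun x => x + t • g x)
        (1 + t • fderiv ℝ g x) (Metric.ball 0 R) x := fun x hx =>
      ((hasFDerivAt_id x).add
        (((hg x (hsub hx)).differentiableAt one_ne_zero).hasFDerivAt.const_smul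
          t)).hasFDerivWithinAt
    have hcv := MeasureTheory.integral_image_eq_integral_abs_det_fderiv_smul μ
      measurableSet_ball hderiv hinj fun _ => (1 : ℝ)
    rw [himage] at hcv
    simp only [smul_eq_mul, mul_one, MeasureTheory.integral_const,
      MeasureTheory.measureReal_restrict_apply_univ] at hcv
    rw [hcv]
    refine MeasureTheory.setIntegral_congr_fun measurableSet_ball fun x hx => ?_
    refine (abs_of_pos (hdet _ ?_)).symm
    rw [norm_smul, Real.norm_of_nonneg ht0.le]
    exact (mul_le_mul_of_nonneg_left ((hC x (hsub hx)).trans (Real.le_coe_toNNReal C))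
      ht0.le).trans_lt (htC.trans_lt hτδ)
  have hzero : ∀ x ∈ Metric.ball (0 : E) R, (1 + fderiv ℝ g x).det = 0 := by
    intro x hx
    have hd := (hK x (hsub hx)).differentiableAt one_ne_zero
    have h1 : 1 + fderiv ℝ g x = fderiv ℝ K x := by
      have : fderiv ℝ g x = fderiv ℝ K x - 1 :=
        (hd.hasFDerivAt.sub (hasFDerivAt_id x)).fderiv
      rw [this, add_sub_cancel]
    rw [h1]
    by_contra hne
    have hsurj : Function.Surjective (fderiv ℝ K x) :=
      (LinearMap.equivOfDetNeZero (fderiv ℝ K x : E →ₗ[ℝ] E) hne).surjective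
    obtain ⟨v, hv⟩ := hsurj (K x)
    have hn := hd.hasFDerivAt.inner ℝ hd.hasFDerivAt
    have hc : (fun y => inner ℝ (K y) (K y)) =ᶠ[nhds x] fun _ => R ^ 2 := by
      filter_upwards [Metric.isOpen_ball.mem_nhds hx] with y hy
      rw [real_inner_self_eq_norm_sq, hKR y (hsub hy)]
    have h2 := congrArg (fun T : E →L[ℝ] ℝ => T v)
      (hn.unique ((hasFDerivAt_const (R ^ 2) x).congr_of_eventuallyEq hc))
    simp [hv, hKR x (hsub hx), hR.ne'] at h2
  obtain ⟨s, hsτ, hs⟩ := (Set.Ioo_infinite hτ).exists_subset_card_eq (Module.finrank ℝ E + 1)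
  have hint (k : ℝ) : MeasureTheory.IntegrableOn (fun x => (1 + k • fderiv ℝ g x).det)
      (Metric.ball (0 : E) R) μ := by
    refine MeasureTheory.IntegrableOn.mono_set (ContinuousOn.integrableOn_compact hcpt ?_) hsub
    exact ContinuousLinearMap.continuous_det.comp_continuousOn
      (continuousOn_const.add (hgd.const_smul k))
  have hμ : μ.real (Metric.ball (0 : E) R) = 0 := by
    calc μ.real (Metric.ball (0 : E) R)
        = ∑ k ∈ s, (Lagrange.basis s id k).eval 1 * μ.real (Metric.ball (0 : E) R) := by
          rw [← Finset.sum_mul, ← Polynomial.eval_finsetSum, Lagrange.sum_basis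
            Function.injective_id.injOn (Finset.card_pos.1 (by omega)), Polynomial.eval_one,
            one_mul]
      _ = ∑ k ∈ s, (Lagrange.basis s id k).eval 1 *
            ∫ x in Metric.ball (0 : E) R, (1 + k • fderiv ℝ g x).det ∂μ :=
          Finset.sum_congr rfl fun k hk => by rw [hvol k (hsτ hk)]
      _ = ∫ x in Metric.ball (0 : E) R, (1 + fderiv ℝ g x).det ∂μ := by
          simp_rw [← MeasureTheory.integral_const_mul]
          rw [← MeasureTheory.integral_finsetSum _ fun k _ => (hint k).const_mul _]
          simp_rw [← ContinuousLinearMap.det_one_add_eq_sum_lagrange (E := E) s (by omega)]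
      _ = 0 := MeasureTheory.setIntegral_eq_zero_of_forall_eq_zero hzero
  have hpos : 0 < μ.real (Metric.ball (0 : E) R) :=
    ENNReal.toReal_pos (Metric.measure_ball_pos μ 0 hR).ne' MeasureTheory.measure_ball_lt_top.ne
  exact hpos.ne' hμ

/-- **Brouwer fixed point theorem** for `C¹` maps of a closed ball into its interior. -/
theorem exists_fixedPoint_of_contDiff_of_norm_lt {E : Type*} [NormedAddCommGroup E]
    [InnerProductSpace ℝ E] [FiniteDimensional ℝ E] {R : ℝ} {f : E → E}
    (hf : ContDiff ℝ 1 f) (hfR : ∀ x, ‖f x‖ < R) : ∃ x, f x = x := by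
  by_contra! hne
  have hR : 0 < R := (norm_nonneg _).trans_lt (hfR 0)
  let u : E → E := fun x => x - f x
  have hu0 (x : E) : u x ≠ 0 := sub_ne_zero.2 (hne x).symm
  have hun (x : E) : 0 < ‖u x‖ ^ 2 := by have := norm_pos_iff.2 (hu0 x); positivity
  let D : E → ℝ := fun x => inner ℝ x (u x) ^ 2 + ‖u x‖ ^ 2 * (R ^ 2 - ‖x‖ ^ 2)
  have hin : ∀ x, ‖x‖ = R → 0 < inner ℝ x (u x) := by
    intro x hx
    have h1 := real_inner_le_norm x (f x)
    have h2 := hfR x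
    simp only [u, inner_sub_right, real_inner_self_eq_norm_sq]
    rw [hx] at *
    nlinarith
  have hD : ∀ x ∈ Metric.closedBall (0 : E) R, 0 < D x := by
    intro x hx
    rw [mem_closedBall_zero_iff] at hx
    rcases hx.eq_or_lt with h | h
    · have := hin x h
      simp only [D, h, sub_self, mul_zero, add_zero]
      positivity
    · have h1 : 0 < R ^ 2 - ‖x‖ ^ 2 := by nlinarith [norm_nonneg x]
      have := mul_pos (hun x) h1
      positivity
  let l : E → ℝ := fun x => (-inner ℝ x (u x) + √(D x)) / ‖u x‖ ^ 2
  have hucd : ContDiff ℝ 1 u := contDiff_id.sub hf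
  have hDcd : ContDiff ℝ 1 D :=
    ((contDiff_id.inner ℝ hucd).pow 2).add
      ((hucd.norm_sq ℝ).mul (contDiff_const.sub (contDiff_id.norm_sq ℝ)))
  refine not_exists_contDiff_retraction_sphere hR (K := fun x => x + l x • u x) ?_ ?_ ?_
  · intro x hx
    have hl : ContDiffAt ℝ 1 l x :=
      ((contDiff_id.inner ℝ hucd).neg.contDiffAt.add
        (hDcd.contDiffAt.sqrt (hD x hx).ne')).div (hucd.norm_sq ℝ).contDiffAt (hun x).ne'
    exact contDiffAt_id.add (hl.smul hucd.contDiffAt)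
  · intro x hx
    have hs := Real.sq_sqrt (hD x hx).le
    have hl : l x * ‖u x‖ ^ 2 = -inner ℝ x (u x) + √(D x) := div_mul_cancel₀ _ (hun x).ne'
    have hsq : ‖x + l x • u x‖ ^ 2 = R ^ 2 := by
      rw [norm_add_sq_real, inner_smul_right, norm_smul, mul_pow, Real.norm_eq_abs, sq_abs]
      have h1 : √(D x) = l x * ‖u x‖ ^ 2 + inner ℝ x (u x) := by linarith
      rw [h1] at hs
      simp only [D] at hs
      refine mul_left_cancel₀ (hun x).ne' ?_
      linear_combination hs
    exact (sq_eq_sq₀ (norm_nonneg _) hR.le).1 hsq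
  · intro x hx
    rw [mem_sphere_zero_iff_norm] at hx
    have : l x = 0 := by
      simp only [l, D, hx, sub_self, mul_zero, add_zero]
      rw [Real.sqrt_sq (hin x hx).le, neg_add_cancel, zero_div]
    simp [this]

/-- A system `wᵀ A_i w = -z_i wᵀ w`, with `w` the vector whose first `m` coordinates are `z`,
whose coordinate `l` is `-1` and whose other coordinates vanish, always has a solution. -/
theorem exists_quadratic_eq_neg_coord {n m : ℕ} (hmn : m ≤ n) (l : Fin n) (hl : m ≤ l)
    (A : Fin m → Matrix (Fin n) (Fin n) ℝ) :
    ∃ w : Fin n → ℝ, w l = -1 ∧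
      ∀ i : Fin m, w ⬝ᵥ (A i) *ᵥ w = -(w (Fin.castLE hmn i) * (w ⬝ᵥ w)) := by
  let W : EuclideanSpace ℝ (Fin m) → Fin n → ℝ := fun z j =>
    if h : j.1 < m then z ⟨j, h⟩ else if j = l then -1 else 0
  have hWl (z) : W z l = -1 := by
    simp only [W]
    rw [dif_neg hl.not_gt, if_pos trivial]
  have hWi (z) (i : Fin m) : W z (Fin.castLE hmn i) = z i := by simp [W]
  have hWW (z) : 0 < W z ⬝ᵥ W z :=
    (dotProduct_self_star_nonneg (W z)).lt_of_ne' fun h => by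
      simpa [dotProduct_self_eq_zero.1 h] using hWl z
  have hWc (j : Fin n) : ContDiff ℝ 1 fun z => W z j := by
    simp only [W]
    split_ifs
    · fun_prop
    · exact contDiff_const
    · exact contDiff_const
  let b : EuclideanSpace ℝ (Fin m) → EuclideanSpace ℝ (Fin m) := fun z =>
    WithLp.toLp 2 fun i => -(W z ⬝ᵥ (A i) *ᵥ W z) / (W z ⬝ᵥ W z)
  have hbc : ContDiff ℝ 1 b := by
    rw [contDiff_euclidean]
    intro i
    refine ContDiff.div (ContDiff.neg ?_) ?_ fun z => (hWW z).ne'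
    · simp only [dotProduct, mulVec]
      fun_prop
    · simp only [dotProduct]
      fun_prop
  have hbb (z) (i : Fin m) : |b z i| ≤ ∑ j, ∑ k, |A i j k| := by
    have hw (j : Fin n) : W z j ^ 2 ≤ W z ⬝ᵥ W z := by
      rw [dotProduct, sq]
      exact Finset.single_le_sum (f := fun j => W z j * W z j)
        (fun k _ => mul_self_nonneg _) (Finset.mem_univ j)
    have hjk (j k : Fin n) : |W z j| * |W z k| ≤ W z ⬝ᵥ W z := by
      have h1 := hw j
      have h2 := hw k
      rw [← sq_abs] at h1 h2
      nlinarith [sq_nonneg (|W z j| - |W z k|)]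
    simp only [b]
    rw [abs_div, abs_neg, abs_of_pos (hWW z), div_le_iff₀ (hWW z), dotProduct, Finset.sum_mul]
    refine (Finset.abs_sum_le_sum_abs _ _).trans (Finset.sum_le_sum fun j _ => ?_)
    rw [mulVec, dotProduct, Finset.mul_sum, Finset.sum_mul]
    refine (Finset.abs_sum_le_sum_abs _ _).trans (Finset.sum_le_sum fun k _ => ?_)
    rw [abs_mul, abs_mul]
    nlinarith [hjk j k, abs_nonneg (A i j k)]
  obtain ⟨z, hz⟩ := exists_fixedPoint_of_contDiff_of_norm_lt
    (R := √(∑ i, (∑ j, ∑ k, |A i j k|) ^ 2) + 1) hbc fun z => by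
      rw [EuclideanSpace.norm_eq]
      refine lt_add_of_le_of_pos (Real.sqrt_le_sqrt (Finset.sum_le_sum fun i _ => ?_)) one_pos
      exact pow_le_pow_left₀ (norm_nonneg _) (hbb z i) 2
  refine ⟨W z, hWl z, fun i => ?_⟩
  have h1 : -(W z ⬝ᵥ (A i) *ᵥ W z) / (W z ⬝ᵥ W z) = z i := congrArg (fun y => y.ofLp i) hz
  rw [div_eq_iff (hWW z).ne'] at h1
  rw [hWi, ← h1, neg_neg]

theorem stmt_4 {n m : ℕ} (hmn : m + 1 ≤ n)
    (A : Fin m → Matrix (Fin n) (Fin n) ℝ) (hA : ∀ i, (A i).IsSymm)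
    (h : ¬ ∃ x : Fin n → ℝ,
        (∀ i : Fin m,
          x ⬝ᵥ (A i) *ᵥ x = x (Fin.castLE (by omega) i) / x ⟨n - 1, by omega⟩) ∧
        x ⟨n - 1, by omega⟩ ∈ Set.Ioo (-1 : ℝ) 0 ∧ x ⬝ᵥ x = 1) :
    ∃ X : Matrix (Fin n) (Fin n) ℝ, X.PosSemidef ∧ X.rank = 1 ∧
      ∀ i, (A i * X).trace = 0 := by
  obtain ⟨w, hwl, hw⟩ := exists_quadratic_eq_neg_coord (by omega) ⟨n - 1, by omega⟩
    (Nat.le_sub_one_of_lt hmn) A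
  by_cases hz : ∀ i : Fin m, w (Fin.castLE (by omega) i) = 0
  · refine ⟨vecMulVec w w, by simpa using posSemidef_vecMulVec_self_star w, ?_, fun i => ?_⟩
    · refine le_antisymm (rank_vecMulVec_le w w) (Nat.one_le_iff_ne_zero.2 fun h0 => ?_)
      rw [Matrix.rank, Submodule.finrank_eq_zero, LinearMap.range_eq_bot] at h0
      have := congrFun (LinearMap.congr_fun h0 (Pi.single ⟨n - 1, by omega⟩ 1))
        ⟨n - 1, by omega⟩
      simp [vecMulVec_apply, hwl] at this
    · rw [mul_vecMulVec, trace_vecMulVec, dotProduct_comm, hw i, hz i, zero_mul, neg_zero]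
  · refine absurd ?_ h
    push Not at hz
    obtain ⟨i, hi⟩ := hz
    have hlt : 1 < w ⬝ᵥ w := by
      have hne : (Fin.castLE (by omega) i : Fin n) ≠ ⟨n - 1, by omega⟩ := by
        simp only [ne_eq, Fin.ext_iff, Fin.val_castLE]
        omega
      have := Finset.add_le_sum (f := fun j => w j * w j) (fun j _ => mul_self_nonneg (w j))
        (Finset.mem_univ (Fin.castLE (by omega) i)) (Finset.mem_univ ⟨n - 1, by omega⟩) hne
      simp only [hwl] at this
      rw [dotProduct]
      nlinarith [mul_self_pos.2 hi]
    have hs0 : 0 < √(w ⬝ᵥ w) := Real.sqrt_pos.2 (by linarith)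
    have hs : √(w ⬝ᵥ w) * √(w ⬝ᵥ w) = w ⬝ᵥ w := Real.mul_self_sqrt (by linarith)
    refine ⟨(√(w ⬝ᵥ w))⁻¹ • w, fun i => ?_, ⟨?_, ?_⟩, ?_⟩
    · simp only [mulVec_smul, smul_dotProduct, dotProduct_smul, Pi.smul_apply, smul_eq_mul,
        hwl, hw i]
      field_simp
      rw [sq, hs, mul_comm]
    · have : (√(w ⬝ᵥ w))⁻¹ < 1 :=
        inv_lt_one_of_one_lt₀ (Real.lt_sqrt_of_sq_lt (by simpa using hlt))
      simp only [Pi.smul_apply, hwl, smul_eq_mul]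
      linarith
    · have := inv_pos.2 hs0
      simp only [Pi.smul_apply, hwl, smul_eq_mul]
      linarith
    · simp only [smul_dotProduct, dotProduct_smul, smul_eq_mul]
      rw [← mul_assoc, ← mul_inv, hs]
      exact inv_mul_cancel₀ (by linarith)
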